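/- Let X be a topological space, E ⊆ X and 0 < α < ω₁. Then the following conditions are equivalent: (i) E is K_α^*-embedded in X, i.e. every bounded function in K_α(E) extends to a bounded function in K_α(X); (ii) E is ambiguously α-embedded in X; (iii) for every segment [c,d] ⊆ ℝ, every mapping f ∈ K_α(E,[c,d]) can be extended to a mapping g ∈ K_α(X,[c,d]). -/

import Mathlib

open Set

universe u v

/-- `A` is functionally open in `X`: `A = f⁻¹((0,1])` for some continuous `f : X → [0,1]`. -/
def FunctionallyOpen (X : Type u) [TopologicalSpace X] (A : Set X) : Prop :=
  ∃ f : X → ℝ, Continuous f ∧ (∀ x, f x ∈ Set.Icc (0:ℝ) 1) ∧ A = f ⁻¹' (Set.Ioc 0 1)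

/-- `A` is functionally closed in `X`: `A = f⁻¹(0)` for some continuous `f : X → [0,1]`. -/
def FunctionallyClosed (X : Type u) [TopologicalSpace X] (A : Set X) : Prop :=
  ∃ f : X → ℝ, Continuous f ∧ (∀ x, f x ∈ Set.Icc (0:ℝ) 1) ∧ A = f ⁻¹' {0}

mutual
/-- The `α`'th functionally additive class in `X`. -/
inductive FunAdd (X : Type u) [TopologicalSpace X] : Ordinal.{0} → Set X → Prop where
  | base (A : Set X) : FunctionallyOpen X A → FunAdd X 0 A
  | union (α : Ordinal.{0}) (hα : α ≠ 0) (β : ℕ → Ordinal.{0}) (hβ : ∀ n, β n < α)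
      (s : ℕ → Set X) (hs : ∀ n, FunMul X (β n) (s n)) : FunAdd X α (⋃ n, s n)

/-- The `α`'th functionally multiplicative class in `X`. -/
inductive FunMul (X : Type u) [TopologicalSpace X] : Ordinal.{0} → Set X → Prop where
  | base (A : Set X) : FunctionallyClosed X A → FunMul X 0 A
  | inter (α : Ordinal.{0}) (hα : α ≠ 0) (β : ℕ → Ordinal.{0}) (hβ : ∀ n, β n < α)
      (s : ℕ → Set X) (hs : ∀ n, FunAdd X (β n) (s n)) : FunMul X α (⋂ n, s n)
end

mutual
/-- The `α`'th (ordinary) additive Borel class in `X`. -/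
inductive BorelAdd (X : Type u) [TopologicalSpace X] : Ordinal.{0} → Set X → Prop where
  | base (A : Set X) : IsOpen A → BorelAdd X 0 A
  | union (α : Ordinal.{0}) (hα : α ≠ 0) (β : ℕ → Ordinal.{0}) (hβ : ∀ n, β n < α)
      (s : ℕ → Set X) (hs : ∀ n, BorelMul X (β n) (s n)) : BorelAdd X α (⋃ n, s n)

/-- The `α`'th (ordinary) multiplicative Borel class in `X`. -/
inductive BorelMul (X : Type u) [TopologicalSpace X] : Ordinal.{0} → Set X → Prop where
  | base (A : Set X) : IsClosed A → BorelMul X 0 A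
  | inter (α : Ordinal.{0}) (hα : α ≠ 0) (β : ℕ → Ordinal.{0}) (hβ : ∀ n, β n < α)
      (s : ℕ → Set X) (hs : ∀ n, BorelAdd X (β n) (s n)) : BorelMul X α (⋂ n, s n)
end

/-- A set is functionally ambiguous of class `α` if it belongs to both the `α`'th functionally
additive and the `α`'th functionally multiplicative class. -/
def FunAmbiguous (X : Type u) [TopologicalSpace X] (α : Ordinal.{0}) (A : Set X) : Prop :=
  FunAdd X α A ∧ FunMul X α A

/-- `f ∈ K_α(X,Y)`: for `α = 0` continuity, for `α > 0` preimages of open sets belong to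
the `α`'th functionally additive class. -/
def KClass {X : Type u} {Y : Type v} [TopologicalSpace X] [TopologicalSpace Y]
    (α : Ordinal.{0}) (f : X → Y) : Prop :=
  (α = 0 → Continuous f) ∧ (α ≠ 0 → ∀ V : Set Y, IsOpen V → FunAdd X α (f ⁻¹' V))

/-- `A` and `B` are `α`-separated in `X`. -/
def AlphaSeparated {X : Type u} [TopologicalSpace X] (α : Ordinal.{0}) (A B : Set X) : Prop :=
  ∃ f : X → ℝ, KClass α f ∧ A ⊆ f ⁻¹' {0} ∧ B ⊆ f ⁻¹' {1}

/-- `X` is an `α`-separated space: any two disjoint sets of the `α`'th (ordinary)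
multiplicative class are `α`-separated. -/
def AlphaSeparatedSpace (X : Type u) [TopologicalSpace X] (α : Ordinal.{0}) : Prop :=
  ∀ A B : Set X, BorelMul X α A → BorelMul X α B → Disjoint A B → AlphaSeparated α A B

/-- `E` is `α`-embedded in `X`. -/
def AlphaEmbedded {X : Type u} [TopologicalSpace X] (α : Ordinal.{0}) (E : Set X) : Prop :=
  (∀ A : Set ↥E, FunAdd ↥E α A → ∃ B : Set X, FunAdd X α B ∧ Subtype.val '' A = B ∩ E) ∧
  (∀ A : Set ↥E, FunMul ↥E α A → ∃ B : Set X, FunMul X α B ∧ Subtype.val '' A = B ∩ E)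

/-- `E` is ambiguously `α`-embedded in `X`. -/
def AmbiguouslyEmbedded {X : Type u} [TopologicalSpace X] (α : Ordinal.{0}) (E : Set X) : Prop :=
  ∀ A : Set ↥E, FunAmbiguous ↥E α A →
    ∃ B : Set X, FunAmbiguous X α B ∧ Subtype.val '' A = B ∩ E

/-- The first uncountable ordinal. -/
noncomputable def omega1 : Ordinal.{0} := (Cardinal.aleph 1).ord

/-- `A` is an `F_σ`-set: a countable union of closed sets. -/
def IsFSigma {X : Type u} [TopologicalSpace X] (A : Set X) : Prop :=
  ∃ F : ℕ → Set X, (∀ n, IsClosed (F n)) ∧ A = ⋃ n, F n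

/-- A space has a countable π-base. -/
def CountablePiBase (Z : Type v) [TopologicalSpace Z] : Prop :=
  ∃ 𝒰 : Set (Set Z), 𝒰.Countable ∧ (∀ U ∈ 𝒰, IsOpen U ∧ U.Nonempty) ∧
    ∀ V : Set Z, IsOpen V → V.Nonempty → ∃ U ∈ 𝒰, U ⊆ V

namespace StmtAux

section
variable {X : Type u} [TopologicalSpace X]

lemma fo_compl {A : Set X} (h : FunctionallyOpen X A) : FunctionallyClosed X Aᶜ := by
  obtain ⟨f, hf, h01, rfl⟩ := h
  refine ⟨f, hf, h01, ?_⟩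
  ext x
  have := h01 x
  simp only [mem_compl_iff, mem_preimage, mem_Ioc, mem_singleton_iff, mem_Icc] at *
  grind

lemma fc_compl {A : Set X} (h : FunctionallyClosed X A) : FunctionallyOpen X Aᶜ := by
  obtain ⟨f, hf, h01, rfl⟩ := h
  refine ⟨f, hf, h01, ?_⟩
  ext x
  have := h01 x
  simp only [mem_compl_iff, mem_preimage, mem_Ioc, mem_singleton_iff, mem_Icc] at *
  grind

lemma compl_aux (α : Ordinal.{0}) : ∀ A : Set X,
    (FunAdd X α A → FunMul X α Aᶜ) ∧ (FunMul X α A → FunAdd X α Aᶜ) := by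
  induction α using WellFoundedLT.induction with
  | ind α ih =>
    intro A
    constructor
    · intro h
      cases h with
      | base _ h => exact FunMul.base _ (fo_compl h)
      | union _ h0 β hβ s hs =>
        rw [compl_iUnion]
        exact FunMul.inter α h0 β hβ _ fun n => (ih _ (hβ n) _).2 (hs n)
    · intro h
      cases h with
      | base _ h => exact FunAdd.base _ (fc_compl h)
      | inter _ h0 β hβ s hs =>
        rw [compl_iInter]
        exact FunAdd.union α h0 β hβ _ fun n => (ih _ (hβ n) _).1 (hs n)

lemma add_compl {α : Ordinal.{0}} {A : Set X} (h : FunAdd X α A) : FunMul X α Aᶜ :=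
  (compl_aux α A).1 h

lemma mul_compl {α : Ordinal.{0}} {A : Set X} (h : FunMul X α A) : FunAdd X α Aᶜ :=
  (compl_aux α A).2 h

lemma mul_lt_add {α β : Ordinal.{0}} (hβ : β < α) {A : Set X} (h : FunMul X β A) :
    FunAdd X α A := by
  have := FunAdd.union (X := X) α (ne_bot_of_gt hβ) (fun _ => β) (fun _ => hβ) (fun _ => A)
    (fun _ => h)
  rwa [iUnion_const] at this

lemma add_lt_add {α β : Ordinal.{0}} (hβ : β < α) {A : Set X} (h : FunAdd X β A) :
    FunAdd X α A := by
  have h0 : α ≠ 0 := ne_bot_of_gt hβ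
  cases h with
  | base _ h =>
    obtain ⟨f, hf, h01, rfl⟩ := h
    have : f ⁻¹' Ioc 0 1 = ⋃ n : ℕ, {x | 1 / ((n : ℝ) + 1) ≤ f x} := by
      ext x
      have h1 := h01 x
      simp only [mem_preimage, mem_Ioc, mem_iUnion, mem_setOf_eq]
      constructor
      · intro h
        obtain ⟨n, hn⟩ := exists_nat_one_div_lt h.1
        exact ⟨n, hn.le⟩
      · rintro ⟨n, hn⟩
        exact ⟨lt_of_lt_of_le (by positivity) hn, h1.2⟩
    rw [this]
    refine FunAdd.union α h0 (fun _ => 0) (fun _ => hβ) _ fun n => FunMul.base _ ?_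
    refine ⟨fun x => max 0 (1 / ((n : ℝ) + 1) - f x), by fun_prop, ?_, ?_⟩
    · intro x
      have h1 := h01 x
      refine ⟨le_max_left _ _, max_le zero_le_one ?_⟩
      have : 1 / ((n : ℝ) + 1) ≤ 1 := by
        rw [div_le_one (by positivity)]
        have := Nat.cast_nonneg (α := ℝ) n
        linarith
      have := h1.1
      linarith
    · ext x
      simp
  | union _ h0' γ hγ s hs =>
    exact FunAdd.union α h0 γ (fun n => (hγ n).trans hβ) s hs

lemma mul_le_mul' {α β : Ordinal.{0}} (hβ : β ≤ α) {A : Set X} (h : FunMul X β A) :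
    FunMul X α A := by
  rcases hβ.eq_or_lt with rfl | hlt
  · exact h
  · have := add_compl (add_lt_add hlt (mul_compl h))
    rwa [compl_compl] at this

lemma mul_inter {α : Ordinal.{0}} {A B : Set X} (hA : FunMul X α A) (hB : FunMul X α B) :
    FunMul X α (A ∩ B) := by
  cases hA with
  | base _ hA =>
    cases hB with
    | base _ hB =>
      obtain ⟨f, hf, hf1, rfl⟩ := hA
      obtain ⟨g, hg, hg1, rfl⟩ := hB
      refine FunMul.base _ ⟨fun x => max (f x) (g x), by fun_prop, fun x => ?_, ?_⟩
      · exact ⟨le_max_of_le_left (hf1 x).1, max_le (hf1 x).2 (hg1 x).2⟩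
      · ext x
        have h1 := hf1 x
        have h2 := hg1 x
        simp only [mem_inter_iff, mem_preimage, mem_singleton_iff, mem_Icc] at *
        grind
    | inter _ h0 => exact absurd rfl h0
  | inter _ h0 β hβ s hs =>
    cases hB with
    | base _ hB => exact absurd rfl h0
    | inter _ _ γ hγ t ht =>
      have : (⋂ n, s n) ∩ (⋂ n, t n) =
          ⋂ n : ℕ, (if n % 2 = 0 then s (n / 2) else t (n / 2)) := by
        ext x
        simp only [mem_inter_iff, mem_iInter]
        constructor
        · rintro ⟨h1, h2⟩ n
          split_ifs
          · exact h1 _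
          · exact h2 _
        · intro h
          refine ⟨fun n => ?_, fun n => ?_⟩
          · simpa using h (2 * n)
          · have := h (2 * n + 1)
            rw [if_neg (by omega), show (2 * n + 1) / 2 = n by omega] at this
            exact this
      rw [this]
      refine FunMul.inter α h0 (fun n => if n % 2 = 0 then β (n / 2) else γ (n / 2)) ?_ _ ?_
      · intro n
        split_ifs
        · exact hβ _
        · exact hγ _
      · intro n
        split_ifs
        · exact hs _
        · exact ht _

lemma add_inter {α : Ordinal.{0}} (h0 : α ≠ 0) {A B : Set X} (hA : FunAdd X α A)
    (hB : FunAdd X α B) : FunAdd X α (A ∩ B) := by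
  cases hA with
  | base _ hA => exact absurd rfl h0
  | union _ _ β hβ s hs =>
    cases hB with
    | base _ hB => exact absurd rfl h0
    | union _ _ γ hγ t ht =>
      have : (⋃ n, s n) ∩ (⋃ n, t n) =
          ⋃ n : ℕ, s n.unpair.1 ∩ t n.unpair.2 := by
        ext x
        simp only [mem_inter_iff, mem_iUnion]
        constructor
        · rintro ⟨⟨i, hi⟩, ⟨j, hj⟩⟩
          exact ⟨Nat.pair i j, by simpa using ⟨hi, hj⟩⟩
        · rintro ⟨n, h1, h2⟩
          exact ⟨⟨_, h1⟩, ⟨_, h2⟩⟩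
      rw [this]
      refine FunAdd.union α h0 (fun n => max (β n.unpair.1) (γ n.unpair.2))
        (fun n => max_lt (hβ _) (hγ _)) _ fun n => ?_
      exact mul_inter (mul_le_mul' (le_max_left _ _) (hs _))
        (mul_le_mul' (le_max_right _ _) (ht _))

lemma add_iUnion {α : Ordinal.{0}} (h0 : α ≠ 0) {A : ℕ → Set X} (hA : ∀ n, FunAdd X α (A n)) :
    FunAdd X α (⋃ n, A n) := by
  have : ∀ n, ∃ (β : ℕ → Ordinal.{0}) (s : ℕ → Set X), (∀ k, β k < α) ∧
      (∀ k, FunMul X (β k) (s k)) ∧ A n = ⋃ k, s k := by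
    intro n
    have h := hA n
    generalize A n = B at h
    cases h with
    | base _ h => exact absurd rfl h0
    | union _ _ β hβ s hs => exact ⟨β, s, hβ, hs, rfl⟩
  choose β s hβ hs hAs using this
  have : (⋃ n, A n) = ⋃ n : ℕ, s n.unpair.1 n.unpair.2 := by
    ext x
    simp only [hAs, mem_iUnion]
    constructor
    · rintro ⟨i, j, h⟩
      exact ⟨Nat.pair i j, by simpa using h⟩
    · rintro ⟨n, h⟩
      exact ⟨_, _, h⟩
  rw [this]
  exact FunAdd.union α h0 (fun n => β n.unpair.1 n.unpair.2) (fun n => hβ _ _) _ fun n => hs _ _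

lemma add_union {α : Ordinal.{0}} (h0 : α ≠ 0) {A B : Set X} (hA : FunAdd X α A)
    (hB : FunAdd X α B) : FunAdd X α (A ∪ B) := by
  have : A ∪ B = ⋃ n : ℕ, if n = 0 then A else B := by
    ext x
    simp only [mem_union, mem_iUnion]
    constructor
    · rintro (h | h)
      · exact ⟨0, by simpa using h⟩
      · exact ⟨1, by simpa using h⟩
    · rintro ⟨n, h⟩
      split_ifs at h
      · exact Or.inl h
      · exact Or.inr h
  rw [this]
  refine add_iUnion h0 fun n => ?_
  split_ifs
  · exact hA
  · exact hB

lemma add_univ {α : Ordinal.{0}} (h0 : α ≠ 0) : FunAdd X α univ := by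
  refine mul_lt_add (β := 0) (bot_lt_iff_ne_bot.2 h0) (FunMul.base _ ⟨fun _ => 0, by fun_prop, ?_, ?_⟩)
  · intro x; simp
  · ext x; simp

lemma add_empty {α : Ordinal.{0}} (h0 : α ≠ 0) : FunAdd X α ∅ := by
  refine mul_lt_add (β := 0) (bot_lt_iff_ne_bot.2 h0) (FunMul.base _ ⟨fun _ => 1, by fun_prop, ?_, ?_⟩)
  · intro x; simp
  · ext x; simp

lemma add_finInter {α : Ordinal.{0}} (h0 : α ≠ 0) {A : ℕ → Set X}
    (hA : ∀ n, FunAdd X α (A n)) (n : ℕ) : FunAdd X α {x | ∀ k < n, x ∈ A k} := by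
  induction n with
  | zero => simpa using add_univ h0
  | succ n ih =>
    have : {x | ∀ k < n + 1, x ∈ A k} = {x | ∀ k < n, x ∈ A k} ∩ A n := by
      ext x
      simp only [mem_setOf_eq, mem_inter_iff, Nat.lt_succ_iff_lt_or_eq]
      grind
    rw [this]
    exact add_inter h0 ih (hA n)

lemma amb_of {α : Ordinal.{0}} {A : Set X} (h1 : FunAdd X α A) (h2 : FunAdd X α Aᶜ) :
    FunAmbiguous X α A := ⟨h1, by simpa using add_compl h2⟩

lemma amb_compl {α : Ordinal.{0}} {A : Set X} (h : FunAmbiguous X α A) : FunAdd X α Aᶜ :=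
  mul_compl h.2

lemma reduction {α : Ordinal.{0}} (h0 : α ≠ 0) {A B : Set X} (hA : FunAdd X α A)
    (hB : FunAdd X α B) (hAB : ∀ x, x ∈ A ∨ x ∈ B) :
    ∃ C, FunAmbiguous X α C ∧ C ⊆ A ∧ Cᶜ ⊆ B := by
  cases hA with
  | base _ hA => exact absurd rfl h0
  | union _ _ β hβ s hs =>
    cases hB with
    | base _ hB => exact absurd rfl h0
    | union _ _ γ hγ t ht =>
      have hs' : ∀ n, FunAdd X α (s n)ᶜ := fun n => add_lt_add (hβ n) (mul_compl (hs n))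
      have ht' : ∀ n, FunAdd X α (t n)ᶜ := fun n => add_lt_add (hγ n) (mul_compl (ht n))
      have hC : (⋃ n, s n ∩ {x | ∀ k < n, x ∈ (t k)ᶜ})ᶜ =
          ⋃ n, t n ∩ {x | ∀ k < n + 1, x ∈ (s k)ᶜ} := by
        ext x
        simp only [mem_compl_iff, mem_iUnion, mem_inter_iff, mem_setOf_eq]
        constructor
        · intro h
          by_cases hx : ∃ n, x ∈ t n
          · classical
            refine ⟨Nat.find hx, Nat.find_spec hx, fun k hk hsk => h ⟨k, hsk, fun j hj => ?_⟩⟩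
            exact Nat.find_min hx (by omega)
          · exfalso
            push Not at hx
            rcases hAB x with h1 | h1
            · obtain ⟨n, hn⟩ := mem_iUnion.1 h1
              exact h ⟨n, hn, fun k _ => hx k⟩
            · obtain ⟨n, hn⟩ := mem_iUnion.1 h1
              exact hx n hn
        · rintro ⟨n, hn, hns⟩ ⟨m, hm, hmt⟩
          rcases lt_or_ge n m with h | h
          · exact hmt n h hn
          · exact hns m (by omega) hm
      refine ⟨⋃ n, s n ∩ {x | ∀ k < n, x ∈ (t k)ᶜ}, amb_of ?_ ?_, ?_, ?_⟩
      · exact add_iUnion h0 fun n => add_inter h0 (mul_lt_add (hβ n) (hs n))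
          (add_finInter h0 ht' n)
      · rw [hC]
        exact add_iUnion h0 fun n => add_inter h0 (mul_lt_add (hγ n) (ht n))
          (add_finInter h0 hs' (n + 1))
      · exact iUnion_mono fun n => inter_subset_left
      · rw [hC]
        exact iUnion_mono fun n => inter_subset_left

lemma k_mk {α : Ordinal.{0}} (h0 : α ≠ 0) {f : X → ℝ}
    (h : ∀ V : Set ℝ, IsOpen V → FunAdd X α (f ⁻¹' V)) : KClass α f :=
  ⟨fun h' => absurd h' h0, fun _ => h⟩

lemma k_comp {α : Ordinal.{0}} (h0 : α ≠ 0) {f : X → ℝ} (hf : KClass α f) {φ : ℝ → ℝ}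
    (hφ : Continuous φ) : KClass α (fun x => φ (f x)) :=
  k_mk h0 fun V hV => hf.2 h0 _ (hV.preimage hφ)

lemma k_const {α : Ordinal.{0}} (h0 : α ≠ 0) (c : ℝ) : KClass α (fun _ : X => c) := by
  refine k_mk h0 fun V _ => ?_
  by_cases hc : c ∈ V
  · simpa [preimage_const_of_mem hc] using add_univ h0
  · simpa [preimage_const_of_notMem hc] using add_empty h0

lemma k_add_ind {α : Ordinal.{0}} (h0 : α ≠ 0) {f : X → ℝ} (hf : KClass α f) {B : Set X}
    (hB : FunAdd X α B) (hB' : FunAdd X α Bᶜ) (c : ℝ) :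
    KClass α (fun x => f x + B.indicator (fun _ => c) x) := by
  refine k_mk h0 fun V hV => ?_
  have : (fun x => f x + B.indicator (fun _ => c) x) ⁻¹' V =
      ((f ⁻¹' ((fun y => y + c) ⁻¹' V)) ∩ B) ∪ ((f ⁻¹' V) ∩ Bᶜ) := by
    ext x
    by_cases hx : x ∈ B <;> simp [hx]
  rw [this]
  exact add_union h0 (add_inter h0 (hf.2 h0 _ (hV.preimage (by fun_prop))) hB)
    (add_inter h0 (hf.2 h0 _ hV) hB')

lemma k_lim {α : Ordinal.{0}} (h0 : α ≠ 0) {G : ℕ → X → ℝ} {g : X → ℝ} {ε : ℕ → ℝ}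
    (hG : ∀ n, KClass α (G n)) (hε : Filter.Tendsto ε Filter.atTop (nhds 0))
    (h : ∀ n x, |G n x - g x| ≤ ε n) : KClass α g := by
  refine k_mk h0 fun V hV => ?_
  have hO : ∀ n, IsOpen {y : ℝ | ∃ r > ε n, Metric.ball y r ⊆ V} := by
    intro n
    rw [Metric.isOpen_iff]
    rintro y ⟨r, hr, hy⟩
    refine ⟨(r - ε n) / 2, by linarith, fun z hz => ⟨(r + ε n) / 2, by linarith, ?_⟩⟩
    refine (Metric.ball_subset_ball' ?_).trans hy
    have := Metric.mem_ball.1 hz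
    linarith
  have : g ⁻¹' V = ⋃ n, (G n) ⁻¹' {y : ℝ | ∃ r > ε n, Metric.ball y r ⊆ V} := by
    ext x
    simp only [mem_preimage, mem_iUnion, mem_setOf_eq]
    constructor
    · intro hx
      obtain ⟨δ, hδ, hb⟩ := Metric.isOpen_iff.1 hV _ hx
      obtain ⟨n, hn⟩ := (hε.eventually (gt_mem_nhds (show (0:ℝ) < δ / 3 by linarith))).exists
      refine ⟨n, 2 * δ / 3, by linarith, (Metric.ball_subset_ball' ?_).trans hb⟩
      rw [Real.dist_eq]
      have := h n x
      linarith
    · rintro ⟨n, r, hr, hb⟩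
      apply hb
      rw [Metric.mem_ball, dist_comm, Real.dist_eq]
      exact (h n x).trans_lt hr
  rw [this]
  exact add_iUnion h0 fun n => (hG n).2 h0 _ (hO n)

end

section
variable {X : Type u} [TopologicalSpace X] {E : Set X}

lemma amb_of_ext {α : Ordinal.{0}} (h0 : α ≠ 0)
    (H : ∀ f : ↥E → ℝ, KClass α f → (∀ x, f x ∈ Set.Icc (0:ℝ) 1) →
      ∃ g : X → ℝ, KClass α g ∧ ∀ x : ↥E, g ↑x = f x) : AmbiguouslyEmbedded α E := by
  intro A hA
  obtain ⟨g, hg, hgE⟩ := H (fun x => (fun _ => (0:ℝ)) x + A.indicator (fun _ => (1:ℝ)) x)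
    (k_add_ind h0 (k_const h0 0) hA.1 (amb_compl hA) 1) (by
      intro x
      by_cases hx : x ∈ A <;> simp [hx])
  obtain ⟨C, hC, h1, h2⟩ := reduction h0 (hg.2 h0 (Ioi (1/3)) isOpen_Ioi)
    (hg.2 h0 (Iio (2/3)) isOpen_Iio) (by
      intro x
      simp only [mem_preimage, mem_Ioi, mem_Iio]
      by_contra! h
      linarith [h.1, h.2])
  refine ⟨C, hC, ?_⟩
  ext x
  constructor
  · rintro ⟨y, hy, rfl⟩
    refine ⟨?_, y.2⟩
    by_contra hn
    have h3 := h2 hn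
    have h4 := hgE y
    simp only [hy, indicator_of_mem] at h4
    simp only [mem_preimage, h4, mem_Iio] at h3
    norm_num at h3
  · rintro ⟨hx, hxE⟩
    refine ⟨⟨x, hxE⟩, ?_, rfl⟩
    by_contra hn
    have h3 := h1 hx
    have h4 := hgE ⟨x, hxE⟩
    simp only [hn, not_false_eq_true, indicator_of_notMem] at h4
    simp only [mem_preimage, h4, mem_Ioi] at h3
    norm_num at h3

lemma step {α : Ordinal.{0}} (h0 : α ≠ 0) (hE : AmbiguouslyEmbedded α E) {r : ℝ} (hr : 0 < r)
    (f : E → ℝ) (hf : KClass α f) (hfr : ∀ x, f x ∈ Icc 0 r) :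
    ∃ B : Set X, FunAmbiguous X α B ∧
      KClass α (fun x : E => f x - B.indicator (fun _ => r / 3) (x : X)) ∧
      ∀ x : E, f x - B.indicator (fun _ => r / 3) (x : X) ∈ Icc 0 (2 / 3 * r) := by
  obtain ⟨C, hC, h1, h2⟩ := reduction h0 (hf.2 h0 (Ioi (r/3)) isOpen_Ioi)
    (hf.2 h0 (Iio (2/3*r)) isOpen_Iio) (by
      intro x
      simp only [mem_preimage, mem_Ioi, mem_Iio]
      by_contra! h
      linarith [h.1, h.2])
  obtain ⟨B, hB, hBC⟩ := hE C hC
  have hiff : ∀ x : E, (x : X) ∈ B ↔ x ∈ C := by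
    intro x
    have : (x : X) ∈ Subtype.val '' C ↔ (x : X) ∈ B ∩ E := by rw [hBC]
    simpa using this.symm
  have heq : (fun x : E => f x - B.indicator (fun _ => r / 3) (x : X)) =
      fun x => f x + C.indicator (fun _ => -(r / 3)) x := by
    funext x
    by_cases hx : x ∈ C
    · have := (hiff x).2 hx
      simp [hx, this, sub_eq_add_neg]
    · have : (x : X) ∉ B := fun h => hx ((hiff x).1 h)
      simp [hx, this]
  refine ⟨B, hB, ?_, ?_⟩
  · rw [heq]
    exact k_add_ind h0 hf hC.1 (amb_compl hC) _
  · intro x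
    rw [congrFun heq x]
    have h5 := hfr x
    by_cases hx : x ∈ C
    · have h3 := h1 hx
      simp only [mem_preimage, mem_Ioi] at h3
      simp only [hx, indicator_of_mem, mem_Icc] at h5 ⊢
      constructor <;> linarith
    · have h3 := h2 hx
      simp only [mem_preimage, mem_Iio] at h3
      simp only [hx, not_false_eq_true, indicator_of_notMem, mem_Icc] at h5 ⊢
      constructor <;> linarith

lemma ext01 {α : Ordinal.{0}} (h0 : α ≠ 0) (hE : AmbiguouslyEmbedded α E)
    (f : E → ℝ) (hf : KClass α f) (hfr : ∀ x, f x ∈ Icc (0:ℝ) 1) :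
    ∃ g : X → ℝ, KClass α g ∧ (∀ x, g x ∈ Icc (0:ℝ) 1) ∧ ∀ x : E, g x = f x := by
  have hpos : ∀ n : ℕ, (0:ℝ) < (2/3)^n := fun n => by positivity
  have hstep := fun (n : ℕ) (f : E → ℝ) (hf : KClass α f ∧ ∀ x, f x ∈ Icc 0 ((2/3:ℝ)^n)) =>
    step h0 hE (hpos n) f hf.1 hf.2
  choose S hS1 hS2 hS3 using hstep
  let F : (n : ℕ) → {f : E → ℝ // KClass α f ∧ ∀ x, f x ∈ Icc 0 ((2/3:ℝ)^n)} := fun n =>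
    Nat.rec ⟨f, hf, by simpa using hfr⟩ (fun n p =>
      ⟨_, hS2 n p.1 p.2, by
        intro x
        rw [pow_succ']
        exact hS3 n p.1 p.2 x⟩) n
  let B : ℕ → Set X := fun n => S n (F n).1 (F n).2
  have hB : ∀ n, FunAmbiguous X α (B n) := fun n => hS1 _ _ _
  have hF : ∀ n (x : E), (F (n+1)).1 x =
    (F n).1 x - (B n).indicator (fun _ => (2/3:ℝ)^n / 3) (x : X) := fun n x => rfl
  have hF0 : ∀ x, (F 0).1 x = f x := fun x => rfl
  let G : ℕ → X → ℝ := fun n => Nat.rec (fun _ => 0) (fun n p x =>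
    p x + (B n).indicator (fun _ => (2/3:ℝ)^n / 3) x) n
  have hG0 : ∀ x, G 0 x = 0 := fun x => rfl
  have hG : ∀ n x, G (n+1) x = G n x + (B n).indicator (fun _ => (2/3:ℝ)^n / 3) x :=
    fun n x => rfl
  have hGK : ∀ n, KClass α (G n) := by
    intro n
    induction n with
    | zero => exact k_const h0 0
    | succ n ih => exact k_add_ind h0 ih (hB n).1 (amb_compl (hB n)) _
  have hind : ∀ n x, (B n).indicator (fun _ => (2/3:ℝ)^n / 3) x ∈ Icc 0 ((2/3:ℝ)^n / 3) := by
    intro n x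
    have := hpos n
    by_cases hx : x ∈ B n
    · simp only [hx, indicator_of_mem, mem_Icc, le_refl, and_true]; positivity
    · simp only [hx, not_false_eq_true, indicator_of_notMem, mem_Icc, le_refl, true_and]
      positivity
  have hmono : ∀ x, Monotone fun n => G n x := fun x => monotone_nat_of_le_succ fun n => by
    have := (hind n x).1
    rw [hG]; linarith
  have hanti : ∀ x, Antitone fun n => G n x + (2/3:ℝ)^n := fun x =>
    antitone_nat_of_succ_le fun n => by
      have := (hind n x).2
      rw [hG, pow_succ]; linarith
  have hg : ∀ x, ∃ y, ∀ n, y ∈ Icc (G n x) (G n x + (2/3:ℝ)^n) := fun x =>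
    ⟨_, mem_iInter.1 ((hmono x).ciSup_mem_iInter_Icc_of_antitone (hanti x)
      fun n => by have := hpos n; dsimp only; linarith)⟩
  choose g hg using hg
  have hlim : Filter.Tendsto (fun n : ℕ => (2/3:ℝ)^n) Filter.atTop (nhds 0) :=
    tendsto_pow_atTop_nhds_zero_of_lt_one (by norm_num) (by norm_num)
  refine ⟨g, k_lim h0 hGK hlim ?_, ?_, ?_⟩
  · intro n x
    have := hg x n
    rw [abs_le]
    constructor <;> linarith [this.1, this.2]
  · intro x
    have := hg x 0
    simpa [hG0] using this
  · intro x
    have hsum : ∀ n, G n x = f x - (F n).1 x := by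
      intro n
      induction n with
      | zero => rw [hG0, hF0, sub_self]
      | succ n ih => rw [hG, hF, ih]; ring
    have hle : ∀ n : ℕ, |g x - f x| ≤ (2/3:ℝ)^n := by
      intro n
      have h1 := hg x n
      have h2 := (F n).2.2 x
      rw [hsum] at h1
      rw [abs_le]
      constructor <;> linarith [h1.1, h1.2, h2.1, h2.2]
    have := ge_of_tendsto' hlim hle
    exact sub_eq_zero.1 (abs_nonpos_iff.1 this)

lemma extcd {α : Ordinal.{0}} (h0 : α ≠ 0) (hE : AmbiguouslyEmbedded α E) (c d : ℝ) (hcd : c ≤ d)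
    (f : E → ℝ) (hf : KClass α f) (hfr : ∀ x, f x ∈ Icc c d) :
    ∃ g : X → ℝ, KClass α g ∧ (∀ x, g x ∈ Icc c d) ∧ ∀ x : E, g x = f x := by
  obtain ⟨g, hg, hg1, hgE⟩ := ext01 h0 hE (fun x => (f x - c) / (d - c))
    (k_comp h0 hf (φ := fun y => (y - c) / (d - c)) (by fun_prop)) (by
      intro x
      have := hfr x
      exact ⟨div_nonneg (by linarith [this.1]) (by linarith),
        div_le_one_of_le₀ (by linarith [this.2]) (by linarith)⟩)
  refine ⟨fun x => c + (d - c) * g x, k_comp h0 hg (φ := fun y => c + (d - c) * y) (by fun_prop),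
    ?_, ?_⟩
  · intro x
    have := hg1 x
    have hd : 0 ≤ d - c := by linarith
    constructor <;> nlinarith [this.1, this.2]
  · intro x
    simp only [hgE]
    rcases hcd.eq_or_lt with rfl | h
    · have := hfr x
      simp only [Icc_self, mem_singleton_iff] at this
      simp [this]
    · have : d - c ≠ 0 := by linarith
      field_simp
      ring

end

end StmtAux

/-- `E` is `K_α^*`-embedded iff `E` is ambiguously `α`-embedded, iff every
`K_α`-mapping of `E` into a segment `[c,d]` extends to a `K_α`-mapping of `X` into `[c,d]`. -/
theorem stmt11 {X : Type u} [TopologicalSpace X] (α : Ordinal.{0}) (hα0 : 0 < α)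
    (hα : α < omega1) (E : Set X) :
    ((∀ f : ↥E → ℝ, KClass α f → (∃ C : ℝ, ∀ x, |f x| ≤ C) →
        ∃ g : X → ℝ, KClass α g ∧ (∃ C : ℝ, ∀ x, |g x| ≤ C) ∧ ∀ x : ↥E, g ↑x = f x) ↔
      AmbiguouslyEmbedded α E) ∧
    (AmbiguouslyEmbedded α E ↔
      ∀ c d : ℝ, c ≤ d → ∀ f : ↥E → ℝ, KClass α f → (∀ x, f x ∈ Set.Icc c d) →
        ∃ g : X → ℝ, KClass α g ∧ (∀ x, g x ∈ Set.Icc c d) ∧ ∀ x : ↥E, g ↑x = f x) := by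
  have h0 : α ≠ 0 := hα0.ne'
  refine ⟨⟨fun H => ?_, fun H => ?_⟩, ⟨fun H => ?_, fun H => ?_⟩⟩
  · refine StmtAux.amb_of_ext h0 fun f hf h01 => ?_
    obtain ⟨g, hg, -, hgE⟩ := H f hf ⟨1, fun x => abs_le.2 ⟨by linarith [(h01 x).1], (h01 x).2⟩⟩
    exact ⟨g, hg, hgE⟩
  · rintro f hf ⟨C, hC⟩
    obtain ⟨g, hg, hgr, hgE⟩ := StmtAux.extcd h0 H (-|C|) |C|
      (by linarith [abs_nonneg C]) f hf
      (fun x => abs_le.1 ((hC x).trans (le_abs_self C)))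
    exact ⟨g, hg, ⟨|C|, fun x => abs_le.2 (hgr x)⟩, hgE⟩
  · exact fun c d hcd f hf hfr => StmtAux.extcd h0 H c d hcd f hf hfr
  · refine StmtAux.amb_of_ext h0 fun f hf h01 => ?_
    obtain ⟨g, hg, -, hgE⟩ := H 0 1 zero_le_one f hf h01
    exact ⟨g, hg, hgE⟩
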